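/- arXiv:2505.08024 — 2 statements merged into one kernel-verified Lean document; each statement's English description precedes it below -/
import Mathlib

section
/- For all natural numbers n and k, the coefficients of the q-binomial coefficient binom(n+k,k)_q are unimodal: writing binom(n+k,k)_q = a₀ + a₁q + ⋯ + a_{nk}q^{nk}, one has a_i ≤ a_{i+1} whenever i + 1 ≤ nk/2 (equivalently, whenever 2(i+1) ≤ nk). -/
open Polynomial

/-- The `q`-integer `[m]_q = 1 + q + q^2 + ⋯ + q^(m-1)` in `ℤ[q]`. -/
noncomputable def qInt (m : ℕ) : Polynomial ℤ := ∑ i ∈ Finset.range m, X ^ i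

/-- The `q`-factorial `[m]!_q = [m]_q · [m-1]_q ⋯ [1]_q`, with `[0]!_q = 1`. -/
noncomputable def qFact : ℕ → Polynomial ℤ
  | 0 => 1
  | m + 1 => qInt (m + 1) * qFact m

/-! ### The `q`-binomial coefficient by its Pascal recursion -/

/-- The Gaussian polynomial `binom(n+k,k)_q`, defined by the `q`-Pascal recursion. -/
noncomputable def gaussPoly : ℕ → ℕ → Polynomial ℤ
  | 0, _ => 1
  | _ + 1, 0 => 1
  | n + 1, k + 1 => gaussPoly n (k + 1) + X ^ (n + 1) * gaussPoly (n + 1) k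

theorem gaussPoly_zero_right (n : ℕ) : gaussPoly n 0 = 1 := by
  cases n <;> simp [gaussPoly]

theorem qInt_add (m n : ℕ) : qInt (m + n) = qInt m + X ^ m * qInt n := by
  simp only [qInt, Finset.sum_range_add, Finset.mul_sum, pow_add]

theorem qFact_succ (m : ℕ) : qFact (m + 1) = qInt (m + 1) * qFact m := rfl

theorem qInt_succ_ne_zero (m : ℕ) : qInt (m + 1) ≠ 0 := by
  intro h
  have := congrArg (Polynomial.eval 0) h
  simp [qInt, Polynomial.eval_finsetSum, Finset.sum_range_succ'] at this

theorem qFact_ne_zero (m : ℕ) : qFact m ≠ 0 := by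
  induction m with
  | zero => simp [qFact]
  | succ m ih => exact mul_ne_zero (qInt_succ_ne_zero m) ih

theorem gaussPoly_mul_qFact (n k : ℕ) : gaussPoly n k * qFact k * qFact n = qFact (n + k) := by
  induction n generalizing k with
  | zero => simp [gaussPoly, qFact]
  | succ n ihn =>
    induction k with
    | zero => simp [gaussPoly, qFact]
    | succ k ihk =>
      have h₁ := ihn (k + 1)
      rw [show n + (k + 1) = n + 1 + k by ring] at h₁
      rw [← add_assoc, qFact_succ (n + 1 + k), show n + 1 + k + 1 = n + 1 + (k + 1) by ring,
        qInt_add, add_mul]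
      nth_rw 1 [← h₁]
      rw [← ihk, gaussPoly, qFact_succ n, qFact_succ k]
      ring

/-! ### Counting partitions in a box -/

/-- The bigrading on the variables `x₀, …, xₙ`: degree one and index. -/
def boxWeight (n : ℕ) (j : Fin (n + 1)) : ℤ × ℤ := (1, (j : ℕ))

/-- The exponent vectors of the monomials in `x₀, …, xₙ` of degree `a` and index sum `b`;
these are the partitions of `b` into at most `a` parts of size at most `n`. -/
def boxSet (n : ℕ) (a b : ℤ) : Set (Fin (n + 1) →₀ ℕ) :=
  {d | Finsupp.weight (boxWeight n) d = (a, b)}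

theorem mem_boxSet {n : ℕ} {a b : ℤ} {d : Fin (n + 1) →₀ ℕ} :
    d ∈ boxSet n a b ↔ ∑ i, (d i : ℤ) = a ∧ ∑ i, (d i : ℤ) * (i : ℕ) = b := by
  simp [boxSet, Finsupp.weight_eq_sum, boxWeight, Prod.ext_iff, Prod.fst_sum, Prod.snd_sum]

theorem boxSet_finite (n : ℕ) (a b : ℤ) : (boxSet n a b).Finite := by
  refine (Finsupp.finite_of_degree_le a.toNat).subset fun d hd => ?_
  have h := (mem_boxSet.1 hd).1
  simp only [Set.mem_ofPred_eq, Finsupp.degree_eq_sum]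
  zify
  omega

theorem boxSet_eq_empty_of_neg (n : ℕ) (a : ℤ) {b : ℤ} (hb : b < 0) : boxSet n a b = ∅ := by
  refine Set.eq_empty_of_forall_notMem fun d hd => hb.not_ge ?_
  rw [← (mem_boxSet.1 hd).2]
  positivity

theorem ncard_boxSet_zero_left (k : ℕ) (b : ℤ) :
    (boxSet 0 k b).ncard = if b = 0 then 1 else 0 := by
  split_ifs with h
  · rw [Set.ncard_eq_one]
    refine ⟨Finsupp.single 0 k, Set.ext fun d => ?_⟩
    simp [mem_boxSet, h, Finsupp.ext_iff]
  · rw [Set.ncard_eq_zero (boxSet_finite _ _ _)]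
    refine Set.eq_empty_of_forall_notMem fun d hd => h ?_
    simpa using (mem_boxSet.1 hd).2.symm

theorem ncard_boxSet_zero_right (n : ℕ) (b : ℤ) :
    (boxSet n 0 b).ncard = if b = 0 then 1 else 0 := by
  have key {d} (hd : d ∈ boxSet n 0 b) (i) : d i = 0 := by
    have := (Finset.sum_eq_zero_iff_of_nonneg (fun i _ => by positivity)).1 (mem_boxSet.1 hd).1 i
    simpa using this
  split_ifs with h
  · rw [Set.ncard_eq_one]
    refine ⟨0, Set.ext fun d => ⟨fun hd => Finsupp.ext (key hd), ?_⟩⟩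
    rintro rfl
    simp [mem_boxSet, h]
  · rw [Set.ncard_eq_zero (boxSet_finite _ _ _)]
    refine Set.eq_empty_of_forall_notMem fun d hd => h ?_
    simpa [key hd] using (mem_boxSet.1 hd).2.symm

theorem mapDomain_castSucc_mem_boxSet {n : ℕ} {a b : ℤ} {d : Fin (n + 1) →₀ ℕ} :
    d.mapDomain Fin.castSucc ∈ boxSet (n + 1) a b ↔ d ∈ boxSet n a b := by
  have h : Finsupp.mapDomain Fin.castSucc d (Fin.last (n + 1)) = 0 :=
    Finsupp.mapDomain_of_notMem_range _ _ (by simp)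
  simp [mem_boxSet, Fin.sum_univ_castSucc (n := n + 1), h,
    Finsupp.mapDomain_apply (Fin.castSucc_injective _)]

theorem add_single_last_mem_boxSet {n : ℕ} {a b : ℤ} {d : Fin (n + 1) →₀ ℕ} :
    d + Finsupp.single (Fin.last n) 1 ∈ boxSet n (a + 1) b ↔ d ∈ boxSet n a (b - n) := by
  simp only [boxSet, Set.mem_ofPred_eq, map_add, Finsupp.weight_single, boxWeight, Prod.ext_iff]
  simp [eq_sub_iff_add_eq]

theorem boxSet_succ (n : ℕ) (a b : ℤ) :
    boxSet (n + 1) (a + 1) b =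
      Finsupp.mapDomain Fin.castSucc '' boxSet n (a + 1) b ∪
        (· + Finsupp.single (Fin.last (n + 1)) 1) '' boxSet (n + 1) a (b - (n + 1 : ℕ)) := by
  ext d
  constructor
  · intro hd
    by_cases h : d (Fin.last (n + 1)) = 0
    · left
      have : Finsupp.mapDomain Fin.castSucc
          (d.comapDomain Fin.castSucc (Fin.castSucc_injective _).injOn) = d := by
        refine Finsupp.mapDomain_comapDomain _ (Fin.castSucc_injective _) _ fun i hi => ?_
        rcases Fin.eq_castSucc_or_eq_last i with ⟨j, rfl⟩ | rfl
        · exact ⟨j, rfl⟩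
        · simp [h] at hi
      exact ⟨_, mapDomain_castSucc_mem_boxSet.1 (this.symm ▸ hd), this⟩
    · right
      have := Finsupp.sub_add_single_one_cancel h
      exact ⟨_, add_single_last_mem_boxSet.1 (this.symm ▸ hd), this⟩
  · rintro (⟨d, hd, rfl⟩ | ⟨d, hd, rfl⟩)
    · exact mapDomain_castSucc_mem_boxSet.2 hd
    · exact add_single_last_mem_boxSet.2 hd

theorem ncard_boxSet_succ (n : ℕ) (a b : ℤ) :
    (boxSet (n + 1) (a + 1) b).ncard =
      (boxSet n (a + 1) b).ncard + (boxSet (n + 1) a (b - (n + 1 : ℕ))).ncard := by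
  rw [boxSet_succ, Set.ncard_union_eq _ ((boxSet_finite _ _ _).image _)
      ((boxSet_finite _ _ _).image _),
    Set.ncard_image_of_injective _ (Finsupp.mapDomain_injective (Fin.castSucc_injective _)),
    Set.ncard_image_of_injective _ (add_left_injective _)]
  rw [Set.disjoint_left]
  rintro _ ⟨d, -, rfl⟩ ⟨e, -, he⟩
  have h : Finsupp.mapDomain Fin.castSucc d (Fin.last (n + 1)) = 0 :=
    Finsupp.mapDomain_of_notMem_range _ _ (by simp)
  simp [← he] at h

theorem coeff_gaussPoly (n k w : ℕ) : (gaussPoly n k).coeff w = (boxSet n k w).ncard := by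
  induction n generalizing k w with
  | zero => simp [gaussPoly, ncard_boxSet_zero_left, Polynomial.coeff_one]
  | succ n ihn =>
    induction k generalizing w with
    | zero => simp [gaussPoly, ncard_boxSet_zero_right, Polynomial.coeff_one]
    | succ k ihk =>
      have h₁ := ihn (k + 1) w
      rw [gaussPoly, Polynomial.coeff_add, h₁, Polynomial.coeff_X_pow_mul', Nat.cast_succ k,
        ncard_boxSet_succ]
      split_ifs with h
      · rw [ihk, Nat.cast_sub h]
        push_cast
        rfl
      · rw [boxSet_eq_empty_of_neg (n + 1) k (b := (w : ℤ) - (n + 1 : ℕ)) (by omega)]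
        simp

/-! ### Derivations of a polynomial ring and weights -/

namespace MvPolynomial

variable {σ R M : Type*} [CommSemiring R] [AddCommMonoid M] {w : σ → M}

theorem IsWeightedHomogeneous.mkDerivation {f : σ → MvPolynomial σ R} {c : M}
    (hf : ∀ i, IsWeightedHomogeneous w (f i) (w i + c)) {p : MvPolynomial σ R} {m : M}
    (hp : IsWeightedHomogeneous w p m) :
    IsWeightedHomogeneous w (mkDerivation R f p) (m + c) := by
  rw [p.as_sum, map_sum]
  refine IsWeightedHomogeneous.sum _ _ _ fun d hd => ?_
  rw [mkDerivation_monomial, ← mem_weightedHomogeneousSubmodule R]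
  refine Submodule.smul_mem _ _ (Submodule.sum_mem _ fun i hi => ?_)
  have h := Finsupp.weight_sub_single_add (w := w) (Finsupp.mem_support_iff.1 hi)
  rw [mem_weightedHomogeneousSubmodule, ← hp (mem_support_iff.1 hd), ← h, add_assoc]
  exact (isWeightedHomogeneous_monomial w _ _ rfl).mul (hf i)

/-- Euler's identity: an additive functional of the weight acts as a derivation. -/
theorem IsWeightedHomogeneous.mkDerivation_smul_X (φ : M →+ R) {p : MvPolynomial σ R} {m : M}
    (hp : IsWeightedHomogeneous w p m) :
    MvPolynomial.mkDerivation R (fun i => φ (w i) • X i) p = φ m • p := by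
  conv_lhs => rw [p.as_sum]
  conv_rhs => rw [p.as_sum]
  rw [map_sum, Finset.smul_sum]
  refine Finset.sum_congr rfl fun d hd => ?_
  rw [mkDerivation_monomial, ← hp (mem_support_iff.1 hd), Finsupp.weight_apply, map_finsuppSum,
    Finsupp.sum, Finsupp.sum, Finset.sum_smul, Finset.smul_sum]
  refine Finset.sum_congr rfl fun i hi => ?_
  have h := Finsupp.sub_add_single_one_cancel (Finsupp.mem_support_iff.1 hi)
  rw [smul_eq_mul, mul_smul_comm, X, monomial_mul, h]
  simp only [smul_monomial, map_nsmul, smul_eq_mul, nsmul_eq_mul]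
  congr 1
  ring

end MvPolynomial

/-! ### The action of `sl₂` on binary forms -/

section Sl2

open MvPolynomial

/-- The variable `x_j`, understood as zero when `j` is out of range. -/
noncomputable def boxVar (n j : ℕ) : MvPolynomial (Fin (n + 1)) ℚ :=
  if h : j < n + 1 then MvPolynomial.X ⟨j, h⟩ else 0

/-- The derivation `x_j ↦ (n - j) x_{j+1}`. -/
noncomputable def boxRaise (n : ℕ) :
    Derivation ℚ (MvPolynomial (Fin (n + 1)) ℚ) (MvPolynomial (Fin (n + 1)) ℚ) :=
  mkDerivation ℚ fun j => ((n : ℚ) - (j : ℕ)) • boxVar n (j + 1)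

/-- The derivation `x_j ↦ j x_{j-1}`. -/
noncomputable def boxLower (n : ℕ) :
    Derivation ℚ (MvPolynomial (Fin (n + 1)) ℚ) (MvPolynomial (Fin (n + 1)) ℚ) :=
  mkDerivation ℚ fun j => ((j : ℕ) : ℚ) • boxVar n (j - 1)

/-- The eigenvalue `2b - na` of the commutator on the part of weight `(a, b)`. -/
def boxEigen (n : ℕ) : ℤ × ℤ →+ ℚ where
  toFun m := 2 * m.2 - n * m.1
  map_zero' := by simp
  map_add' x y := by push_cast [Prod.fst_add, Prod.snd_add]; ring

theorem boxVar_of_lt {n j : ℕ} (h : j < n + 1) : boxVar n j = MvPolynomial.X ⟨j, h⟩ := dif_pos h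

theorem isWeightedHomogeneous_boxVar (n j : ℕ) :
    IsWeightedHomogeneous (boxWeight n) (boxVar n j) (1, (j : ℤ)) := by
  unfold boxVar
  split_ifs
  · exact isWeightedHomogeneous_X ℚ _ _
  · exact isWeightedHomogeneous_zero ℚ _ _

theorem boxRaise_boxVar (n j : ℕ) :
    boxRaise n (boxVar n j) = ((n : ℚ) - j) • boxVar n (j + 1) := by
  by_cases h : j < n + 1
  · rw [boxVar_of_lt h, boxRaise, MvPolynomial.mkDerivation_X]
  · simp [boxVar, h, show ¬ j < n by omega]

theorem boxLower_boxVar {n j : ℕ} (h : j < n + 1) :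
    boxLower n (boxVar n j) = (j : ℚ) • boxVar n (j - 1) := by
  rw [boxVar_of_lt h, boxLower, MvPolynomial.mkDerivation_X]

theorem boxRaise_lie_boxLower (n : ℕ) :
    ⁅boxRaise n, boxLower n⁆ =
      mkDerivation ℚ fun i => boxEigen n (boxWeight n i) • MvPolynomial.X i := by
  refine derivation_ext fun ⟨j, hj⟩ => ?_
  rw [MvPolynomial.mkDerivation_X, ← boxVar_of_lt hj, Derivation.commutator_apply,
    boxLower_boxVar hj, boxRaise_boxVar, Derivation.map_smul, Derivation.map_smul, boxRaise_boxVar]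
  have h₁ : (j : ℚ) • ((n : ℚ) - (j - 1 : ℕ)) • boxVar n (j - 1 + 1) =
      ((j : ℚ) * (n - j + 1)) • boxVar n j := by
    rcases j with _ | j
    · simp
    · rw [smul_smul]
      congr 2
      push_cast [Nat.add_sub_cancel]
      ring
  have h₂ : ((n : ℚ) - j) • boxLower n (boxVar n (j + 1)) =
      (((n : ℚ) - j) * (j + 1)) • boxVar n j := by
    rcases (Nat.lt_succ_iff_lt_or_eq.1 hj) with h | rfl
    · rw [boxLower_boxVar (by omega), smul_smul]
      push_cast [Nat.add_sub_cancel]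
      rfl
    · simp
  rw [h₁, h₂, ← sub_smul]
  congr 1
  simp only [boxEigen, boxWeight, AddMonoidHom.coe_mk, ZeroHom.coe_mk]
  push_cast
  ring

variable {n : ℕ} {a b : ℤ} {p : MvPolynomial (Fin (n + 1)) ℚ}

theorem boxRaise_boxLower_apply (hp : IsWeightedHomogeneous (boxWeight n) p (a, b)) :
    boxRaise n (boxLower n p) = boxLower n (boxRaise n p) + (2 * b - n * a : ℚ) • p := by
  rw [← sub_eq_iff_eq_add', ← Derivation.commutator_apply, boxRaise_lie_boxLower,
    hp.mkDerivation_smul_X]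
  rfl

theorem isWeightedHomogeneous_boxRaise (hp : IsWeightedHomogeneous (boxWeight n) p (a, b)) :
    IsWeightedHomogeneous (boxWeight n) (boxRaise n p) (a, b + 1) := by
  have := hp.mkDerivation (R := ℚ) (c := ((0 : ℤ), (1 : ℤ)))
    (f := fun j : Fin (n + 1) => ((n : ℚ) - (j : ℕ)) • boxVar n (j + 1)) fun j => ?_
  · simpa [boxRaise] using this
  · rw [← mem_weightedHomogeneousSubmodule]
    exact Submodule.smul_mem _ _ (by simpa [boxWeight] using isWeightedHomogeneous_boxVar n (j + 1))

theorem isWeightedHomogeneous_boxLower (hp : IsWeightedHomogeneous (boxWeight n) p (a, b)) :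
    IsWeightedHomogeneous (boxWeight n) (boxLower n p) (a, b - 1) := by
  have := hp.mkDerivation (R := ℚ) (c := ((0 : ℤ), (-1 : ℤ)))
    (f := fun j : Fin (n + 1) => ((j : ℕ) : ℚ) • boxVar n (j - 1)) fun j => ?_
  · simpa [boxLower, sub_eq_add_neg] using this
  · rcases Nat.eq_zero_or_pos (j : ℕ) with h | h
    · simpa [h] using isWeightedHomogeneous_zero ℚ _ _
    · rw [← mem_weightedHomogeneousSubmodule]
      refine Submodule.smul_mem _ _ ?_
      have := isWeightedHomogeneous_boxVar n (j - 1)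
      rw [Nat.cast_pred h] at this
      simpa [boxWeight, sub_eq_add_neg] using this

theorem isWeightedHomogeneous_boxLower_iterate
    (hp : IsWeightedHomogeneous (boxWeight n) p (a, b)) (j : ℕ) :
    IsWeightedHomogeneous (boxWeight n) ((boxLower n)^[j] p) (a, b - j) := by
  induction j with
  | zero => simpa using hp
  | succ j ih =>
    rw [Function.iterate_succ_apply', Nat.cast_succ, ← sub_sub]
    exact isWeightedHomogeneous_boxLower ih

theorem exists_boxRaise_boxLower_iterate
    (hp : IsWeightedHomogeneous (boxWeight n) p (a, b)) (hb : 2 * b < n * a)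
    (h : boxRaise n p = 0) (j : ℕ) :
    ∃ c : ℚ, c < 0 ∧ boxRaise n ((boxLower n)^[j + 1] p) = c • (boxLower n)^[j] p := by
  have hb' : (2 * b : ℚ) < n * a := by exact_mod_cast hb
  induction j with
  | zero => exact ⟨2 * b - n * a, by linarith, by simpa [h] using boxRaise_boxLower_apply hp⟩
  | succ j ih =>
    obtain ⟨c, hc, hj⟩ := ih
    refine ⟨c + (2 * (b - (j + 1 : ℕ) : ℤ) - n * a), ?_, ?_⟩
    · push_cast
      linarith [(Nat.cast_nonneg j : (0 : ℚ) ≤ j)]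
    · rw [Function.iterate_succ_apply' _ (j + 1),
        boxRaise_boxLower_apply (isWeightedHomogeneous_boxLower_iterate hp (j + 1)), hj,
        Derivation.map_smul, ← Function.iterate_succ_apply' (boxLower n) j, ← add_smul]

/-- The raising operator is injective below the middle weight. -/
theorem eq_zero_of_boxRaise_eq_zero (hp : IsWeightedHomogeneous (boxWeight n) p (a, b))
    (hb : 2 * b < n * a) (h : boxRaise n p = 0) : p = 0 := by
  have descend (j : ℕ) : (boxLower n)^[j] p = 0 → p = 0 := by
    induction j with
    | zero => exact id
    | succ j ih =>
      intro hj
      obtain ⟨c, hc, hcj⟩ := exists_boxRaise_boxLower_iterate hp hb h j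
      rw [hj, map_zero] at hcj
      exact ih ((smul_eq_zero.1 hcj.symm).resolve_left hc.ne)
  refine descend (b.toNat + 1)
    ((isWeightedHomogeneous_boxLower_iterate hp _).eq_zero_of_no_monomials fun d hd => ?_)
  have : d ∈ boxSet n a (b - (b.toNat + 1 : ℕ)) := hd
  rwa [boxSet_eq_empty_of_neg n a (by omega)] at this

/-- The monomial coordinates on a weight space. -/
noncomputable def boxSpaceEquiv (n : ℕ) (a b : ℤ) :
    weightedHomogeneousSubmodule ℚ (boxWeight n) (a, b) ≃ₗ[ℚ] (boxSet n a b →₀ ℚ) :=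
  LinearEquiv.ofEq _ _ (weightedHomogeneousSubmodule_eq_finsupp_supported ℚ _ _) ≪≫ₗ
    AddMonoidAlgebra.supportedEquivFinsupp _

theorem finrank_boxSpace (n : ℕ) (a b : ℤ) :
    Module.finrank ℚ (weightedHomogeneousSubmodule ℚ (boxWeight n) (a, b)) =
      (boxSet n a b).ncard := by
  have := (boxSet_finite n a b).fintype
  rw [(boxSpaceEquiv n a b).finrank_eq, Module.finrank_finsupp_self, Set.ncard_eq_toFinset_card',
    Set.toFinset_card]

theorem ncard_boxSet_le (h : 2 * b < n * a) : (boxSet n a b).ncard ≤ (boxSet n a (b + 1)).ncard := by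
  have := (boxSet_finite n a (b + 1)).to_subtype
  have := Module.Finite.equiv (boxSpaceEquiv n a (b + 1)).symm
  rw [← finrank_boxSpace, ← finrank_boxSpace]
  refine LinearMap.finrank_le_finrank_of_injective
    (f := (boxRaise n).toLinearMap.restrict fun p hp => isWeightedHomogeneous_boxRaise hp) ?_
  rw [injective_iff_map_eq_zero]
  rintro ⟨p, hp⟩ h₀
  exact Subtype.ext (eq_zero_of_boxRaise_eq_zero hp h (congrArg Subtype.val h₀))

end Sl2

/-- The coefficients of `binom(n+k,k)_q` are unimodal: `a_i ≤ a_(i+1)` whenever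
`2(i+1) ≤ nk`. -/
theorem qbinom_coeff_unimodal (n k : ℕ) (P : Polynomial ℤ)
    (hP : P * qFact k * qFact n = qFact (n + k)) (i : ℕ) (hi : 2 * (i + 1) ≤ n * k) :
    P.coeff i ≤ P.coeff (i + 1) := by
  obtain rfl : P = gaussPoly n k := by
    rw [← gaussPoly_mul_qFact] at hP
    exact mul_right_cancel₀ (qFact_ne_zero k) (mul_right_cancel₀ (qFact_ne_zero n) hP)
  rw [coeff_gaussPoly, coeff_gaussPoly, Nat.cast_succ i]
  exact_mod_cast ncard_boxSet_le (n := n) (a := k) (b := i) (by norm_cast; omega)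
end

section
/- For every natural number n, the coefficient of q^{n+2} in the q-binomial coefficient binom(n+4,4)_q equals p₄(n+2) - p₄(1) - p₄(0), i.e., equals p₄(n+2) - 2. -/
open Polynomial

/-- `partnum k m = p_k(m)`, the number of partitions of `m` all of whose parts have size
at most `k`. -/
def partnum (k m : ℕ) : ℕ :=
  Fintype.card {p : Nat.Partition m // ∀ j ∈ p.parts, j ≤ k}

open scoped PowerSeries.WithPiTopology in
/-- The generating function of `partnum k` is inverse to `∏_{i=1}^k (1 - X^i)`. -/
theorem mk_partnum_mul_prod_one_sub_X_pow (k : ℕ) :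
    (PowerSeries.mk fun m ↦ (partnum k m : ℤ)) *
      ∏ i ∈ Finset.range k, (1 - PowerSeries.X ^ (i + 1)) = 1 := by
  have hprod := Nat.Partition.hasProd_powerSeriesMk_card_restricted ℤ (· ≤ k)
  have hfin := hasProd_prod_of_ne_finset_one (L := .unconditional ℕ) (s := Finset.range k)
    (f := fun i ↦ if i + 1 ≤ k then ∑' j : ℕ, (PowerSeries.X : PowerSeries ℤ) ^ ((i + 1) * j)
      else 1) (fun i hi ↦ if_neg (by simpa using hi))
  have hcard : (PowerSeries.mk fun m ↦ (partnum k m : ℤ)) =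
      PowerSeries.mk fun m ↦ ((Nat.Partition.restricted m (· ≤ k)).card : ℤ) := by
    ext m
    simp only [PowerSeries.coeff_mk, partnum, Nat.Partition.restricted, Fintype.card_subtype]
  rw [hcard, hprod.unique hfin, ← Finset.prod_mul_distrib]
  refine Finset.prod_eq_one fun i hi ↦ ?_
  rw [if_pos (by simpa using hi)]
  simp_rw [pow_mul]
  exact PowerSeries.WithPiTopology.tsum_pow_mul_one_sub_of_constantCoeff_eq_zero (by simp)

theorem qFact_mul_one_sub_X_pow (m : ℕ) :
    qFact m * (1 - X) ^ m = ∏ i ∈ Finset.range m, (1 - X ^ (i + 1)) := by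
  induction m with
  | zero => simp [qFact]
  | succ m ih =>
    have hgeom : qInt (m + 1) * (1 - X) = 1 - X ^ (m + 1) := geom_sum_mul_neg X (m + 1)
    rw [Finset.prod_range_succ, ← ih, ← hgeom, qFact]
    ring

theorem one_sub_X_pow_ne_zero {i : ℕ} (hi : i ≠ 0) : (1 - X ^ i : Polynomial ℤ) ≠ 0 := by
  intro h
  have := congrArg (Polynomial.eval 0) h
  simp [hi] at this

theorem qbinom_mul_prod_one_sub_X_pow {n k : ℕ} {P : Polynomial ℤ}
    (hP : P * qFact k * qFact n = qFact (n + k)) :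
    P * ∏ i ∈ Finset.range k, (1 - X ^ (i + 1)) =
      ∏ i ∈ Finset.range k, (1 - X ^ (n + i + 1)) := by
  have hne : ∏ i ∈ Finset.range n, (1 - X ^ (i + 1) : Polynomial ℤ) ≠ 0 :=
    Finset.prod_ne_zero_iff.mpr fun i _ ↦ one_sub_X_pow_ne_zero i.succ_ne_zero
  apply mul_left_cancel₀ hne
  rw [← Finset.prod_range_add (fun i ↦ (1 - X ^ (i + 1) : Polynomial ℤ)),
    ← qFact_mul_one_sub_X_pow, ← qFact_mul_one_sub_X_pow, ← qFact_mul_one_sub_X_pow, ← hP]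
  ring

theorem qbinom_eq_mk_partnum_mul {n k : ℕ} {P : Polynomial ℤ}
    (hP : P * qFact k * qFact n = qFact (n + k)) :
    (P : PowerSeries ℤ) = (PowerSeries.mk fun m ↦ (partnum k m : ℤ)) *
      ∏ i ∈ Finset.range k, (1 - PowerSeries.X ^ (n + i + 1)) := by
  have h := congrArg (Polynomial.coeToPowerSeries.ringHom (R := ℤ))
    (qbinom_mul_prod_one_sub_X_pow hP)
  simp only [map_mul, map_prod, map_sub, map_one, map_pow,
    Polynomial.coeToPowerSeries.ringHom_apply, Polynomial.coe_X] at h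
  rw [← h, mul_left_comm, mk_partnum_mul_prod_one_sub_X_pow, mul_one]

theorem partnum_zero_right (k : ℕ) : partnum k 0 = 1 := by
  rw [partnum, Fintype.card_eq_one_iff]
  exact ⟨⟨default, by simp⟩, fun p ↦ Subtype.ext (Subsingleton.elim _ _)⟩

theorem partnum_one_right {k : ℕ} (hk : 1 ≤ k) : partnum k 1 = 1 := by
  rw [partnum, Fintype.card_eq_one_iff]
  exact ⟨⟨default, by simpa using hk⟩, fun p ↦ Subtype.ext (Subsingleton.elim _ _)⟩

/-- The coefficient of `q^(n+2)` in `binom(n+4,4)_q` equals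
`p₄(n+2) - p₄(1) - p₄(0) = p₄(n+2) - 2`. -/
theorem qbinom_coeff_transition (n : ℕ) (P : Polynomial ℤ)
    (hP : P * qFact 4 * qFact n = qFact (n + 4)) :
    P.coeff (n + 2) = (partnum 4 (n + 2) : ℤ) - partnum 4 1 - partnum 4 0 ∧
      P.coeff (n + 2) = (partnum 4 (n + 2) : ℤ) - 2 := by
  have hcoeff : P.coeff (n + 2) = (partnum 4 (n + 2) : ℤ) - partnum 4 1 - partnum 4 0 := by
    have hexpand : ∃ R : PowerSeries ℤ,
        ∏ i ∈ Finset.range 4, (1 - PowerSeries.X ^ (n + i + 1)) =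
          1 - PowerSeries.X ^ (n + 1) - PowerSeries.X ^ (n + 2) + R * PowerSeries.X ^ (n + 3) := by
      refine ⟨PowerSeries.X ^ n - (1 - PowerSeries.X ^ (n + 1)) * (1 - PowerSeries.X ^ (n + 2)) *
        (1 + PowerSeries.X - PowerSeries.X ^ (n + 4)), ?_⟩
      simp only [Finset.prod_range_succ, Finset.prod_range_zero]
      ring
    obtain ⟨R, hR⟩ := hexpand
    rw [← Polynomial.coeff_coe, qbinom_eq_mk_partnum_mul hP, hR]
    simp [mul_add, mul_sub, ← mul_assoc, PowerSeries.coeff_mul_X_pow']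
  refine ⟨hcoeff, ?_⟩
  rw [hcoeff, partnum_zero_right, partnum_one_right (by norm_num)]
  ring
end
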